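/- arXiv:1412.5237 — 2 statements merged into one kernel-verified Lean document; each statement's English description precedes it below -/
import Mathlib

section
/- Let v : [A,B] → ℂ be twice continuously differentiable and let λ ∈ ℂ. Define u : [a,b] → ℂ by u(x) = ρ(l⁻¹(x)) v(l⁻¹(x)). Then v satisfies the Sturm–Liouville equation (p(y) v′(y))′ − q(y) v(y) = −λ r(y) v(y) for all y ∈ (A,B) if and only if u satisfies the Schrödinger equation u″(x) − Q(x) u(x) = −λ u(x) for all x ∈ (a,b), where Q(x) = q(y)/r(y) − (r(y)⁻³ p(y))^{1/4} · (p(y) · ((p r)^{−1/4})′(y))′ evaluated at y = l⁻¹(x). -/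
open MeasureTheory

/-- The derivative of a function that is `C²` at a point is differentiable there. -/
lemma ContDiffAt.differentiableAt_deriv_of_two {E : Type*} [NormedAddCommGroup E]
    [NormedSpace ℝ E] {f : ℝ → E} {y : ℝ} (hf : ContDiffAt ℝ 2 f y) :
    DifferentiableAt ℝ (deriv f) y := by
  have h : ContDiffAt ℝ 1 (fderiv ℝ f) y := hf.fderiv_right (by norm_num)
  exact (h.differentiableAt one_ne_zero).clm_apply (differentiableAt_const (1 : ℝ))

/-- The fundamental theorem of calculus in strict form at an interior point of `[A, B]`. -/
lemma ContinuousOn.hasStrictDerivAt_integral_of_mem_Ioo {f : ℝ → ℝ} {A B y₀ y : ℝ}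
    (hf : ContinuousOn f (Set.Icc A B)) (hy₀ : y₀ ∈ Set.Icc A B) (hy : y ∈ Set.Ioo A B) :
    HasStrictDerivAt (fun t => ∫ s in y₀..t, f s) (f y) y := by
  have hnhds : Set.Icc A B ∈ nhds y := Icc_mem_nhds hy.1 hy.2
  refine intervalIntegral.integral_hasStrictDerivAt_right
    (hf.mono (Set.uIcc_subset_Icc hy₀ (Set.Ioo_subset_Icc_self hy))).intervalIntegrable ?_
    (hf.continuousAt hnhds)
  exact ⟨Set.Icc A B, hnhds, hf.aestronglyMeasurable measurableSet_Icc⟩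

/-- The algebraic relations between `w = (p r)^(-1/4)`, the metric factor `√(r/p)` and the
coefficient `(p r⁻³)^(1/4)`. -/
lemma liouville_weight_identities {p r : ℝ} (hp : 0 < p) (hr : 0 < r) :
    (Real.sqrt (r / p))⁻¹ = p * ((p * r) ^ (-(1 / 4) : ℝ)) ^ 2 ∧
      p * r * ((p * r) ^ (-(1 / 4) : ℝ)) ^ 4 = 1 ∧
      (p / r ^ 3) ^ (1 / 4 : ℝ) = p * ((p * r) ^ (-(1 / 4) : ℝ)) ^ 3 := by
  have hpr : 0 < p * r := mul_pos hp hr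
  have hw : 0 < (p * r) ^ (-(1 / 4) : ℝ) := Real.rpow_pos_of_pos hpr _
  have h4 : p * r * ((p * r) ^ (-(1 / 4) : ℝ)) ^ 4 = 1 := by
    rw [← Real.rpow_natCast, ← Real.rpow_mul hpr.le]
    norm_num
    rw [Real.rpow_neg_one]
    field_simp
  set w := (p * r) ^ (-(1 / 4) : ℝ)
  refine ⟨?_, h4, ?_⟩
  · rw [← Real.sqrt_inv, Real.sqrt_eq_iff_mul_self_eq_of_pos (by positivity)]
    field_simp
    linear_combination h4
  · have h : p / r ^ 3 = (p * w ^ 3) ^ 4 := by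
      have : (p * r * w ^ 4) ^ 3 = 1 := by rw [h4, one_pow]
      field_simp
      linear_combination -this
    rw [h, ← Real.rpow_natCast, ← Real.rpow_mul (by positivity)]
    norm_num

/-- If `Dv`, `Dw` denote the derivatives of `v` and `w`, the Liouville quasi-derivative
`w (p Dv) - v (p Dw)` is differentiable, with derivative `w D(p Dv) - v D(p Dw)`. -/
lemma hasDerivAt_liouville_quasiDerivative {p w : ℝ → ℝ} {v : ℝ → ℂ} {y : ℝ}
    (hp : ContDiffAt ℝ 2 p y) (hw : ContDiffAt ℝ 2 w y) (hv : ContDiffAt ℝ 2 v y) :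
    HasDerivAt (fun t => (w t : ℂ) * ((p t : ℂ) * deriv v t) - v t * ((p t * deriv w t : ℝ) : ℂ))
      ((w y : ℂ) * deriv (fun t => (p t : ℂ) * deriv v t) y -
        v y * ((deriv (fun t => p t * deriv w t) y : ℝ) : ℂ)) y := by
  have hpd := (hp.differentiableAt two_ne_zero).hasDerivAt
  have hwd := (hw.differentiableAt two_ne_zero).hasDerivAt
  have hvd := (hv.differentiableAt two_ne_zero).hasDerivAt
  have hpv : HasDerivAt (fun t => (p t : ℂ) * deriv v t) _ y :=
    hpd.ofReal_comp.mul hv.differentiableAt_deriv_of_two.hasDerivAt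
  have hpw : HasDerivAt (fun t => p t * deriv w t) _ y :=
    hpd.mul hw.differentiableAt_deriv_of_two.hasDerivAt
  have h := (hwd.ofReal_comp.mul hpv.differentiableAt.hasDerivAt).sub
    (hvd.mul hpw.differentiableAt.hasDerivAt.ofReal_comp)
  refine h.congr_deriv ?_
  push_cast
  ring

theorem liouville_transformation_equation_equivalence
    (A B : ℝ) (hAB : A < B)
    (p r : ℝ → ℝ) (q : ℝ → ℂ)
    (hp : ContDiffOn ℝ 2 p (Set.Icc A B))
    (hr : ContDiffOn ℝ 2 r (Set.Icc A B))
    (hq : ContinuousOn q (Set.Icc A B))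
    (hppos : ∀ y ∈ Set.Icc A B, 0 < p y)
    (hrpos : ∀ y ∈ Set.Icc A B, 0 < r y)
    (y₀ : ℝ) (hy₀ : y₀ ∈ Set.Icc A B)
    (l : ℝ → ℝ) (hl : ∀ y, l y = ∫ s in y₀..y, Real.sqrt (r s / p s))
    (ρ : ℝ → ℝ) (hρ : ∀ y, ρ y = (p y * r y) ^ (1 / 4 : ℝ))
    (a b : ℝ) (ha : a = l A) (hb : b = l B)
    (hmono : StrictMonoOn l (Set.Icc A B))
    (linv : ℝ → ℝ)
    (hlinv_maps : Set.MapsTo linv (Set.Icc a b) (Set.Icc A B))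
    (hlinv_left : ∀ y ∈ Set.Icc A B, linv (l y) = y)
    (hlinv_right : ∀ x ∈ Set.Icc a b, l (linv x) = x)
    (Q : ℝ → ℂ)
    (hQ : ∀ x, Q x = q (linv x) / (r (linv x) : ℂ) -
      (((p (linv x) / (r (linv x)) ^ 3) ^ (1 / 4 : ℝ) *
        deriv (fun t => p t * deriv (fun s => (p s * r s) ^ (-(1 / 4) : ℝ)) t) (linv x) : ℝ) : ℂ))
    (lam : ℂ)
    (v : ℝ → ℂ) (hv : ContDiffOn ℝ 2 v (Set.Icc A B))
    (u : ℝ → ℂ) (hu : ∀ x, u x = (ρ (linv x) : ℂ) * v (linv x)) :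
    (∀ y ∈ Set.Ioo A B,
        deriv (fun t => (p t : ℂ) * deriv v t) y - q y * v y = -lam * (r y : ℂ) * v y) ↔
      (∀ x ∈ Set.Ioo a b,
        deriv (deriv u) x - Q x * u x = -lam * u x) := by
  set w : ℝ → ℝ := fun s => (p s * r s) ^ (-(1 / 4) : ℝ) with hw
  set G : ℝ → ℂ := fun t =>
    (w t : ℂ) * ((p t : ℂ) * deriv v t) - v t * ((p t * deriv w t : ℝ) : ℂ) with hG
  have hnhds {y : ℝ} (hy : y ∈ Set.Ioo A B) : Set.Icc A B ∈ nhds y := Icc_mem_nhds hy.1 hy.2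
  have hwpos {y : ℝ} (hy : y ∈ Set.Icc A B) : 0 < w y :=
    Real.rpow_pos_of_pos (mul_pos (hppos y hy) (hrpos y hy)) _
  have hρw {y : ℝ} (hy : y ∈ Set.Icc A B) : ρ y = (w y)⁻¹ := by
    rw [hρ, hw, ← Real.rpow_neg (mul_pos (hppos y hy) (hrpos y hy)).le, neg_neg]
  have hwC {y : ℝ} (hy : y ∈ Set.Ioo A B) : ContDiffAt ℝ 2 w y := by
    have hy' := Set.Ioo_subset_Icc_self hy
    exact ((hp.contDiffAt (hnhds hy)).mul (hr.contDiffAt (hnhds hy))).rpow_const_of_ne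
      (mul_pos (hppos y hy') (hrpos y hy')).ne'
  have hlinv_Ioo {x : ℝ} (hx : x ∈ Set.Ioo a b) : linv x ∈ Set.Ioo A B := by
    have hx' := Set.Ioo_subset_Icc_self hx
    have hy := hlinv_maps hx'
    refine ⟨lt_of_le_of_ne hy.1 fun h => hx.1.ne ?_, lt_of_le_of_ne hy.2 fun h => hx.2.ne ?_⟩
    · rw [ha, h, hlinv_right x hx']
    · rw [hb, ← h, hlinv_right x hx']
  have hlinv_deriv {x : ℝ} (hx : x ∈ Set.Ioo a b) :
      HasDerivAt linv (p (linv x) * w (linv x) ^ 2) x := by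
    have hy := hlinv_Ioo hx
    have hy' := Set.Ioo_subset_Icc_self hy
    have hcont : ContinuousOn (fun s => Real.sqrt (r s / p s)) (Set.Icc A B) :=
      (hr.continuousOn.div hp.continuousOn fun s hs => (hppos s hs).ne').sqrt
    have hl' : HasStrictDerivAt l (Real.sqrt (r (linv x) / p (linv x))) (linv x) := by
      rw [funext hl]
      exact hcont.hasStrictDerivAt_integral_of_mem_Ioo hy₀ hy
    have h := hl'.to_local_left_inverse
      (Real.sqrt_pos.2 (div_pos (hrpos _ hy') (hppos _ hy'))).ne'
      (Filter.mem_of_superset (hnhds hy) hlinv_left)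
    rw [hlinv_right x (Set.Ioo_subset_Icc_self hx),
      (liouville_weight_identities (hppos _ hy') (hrpos _ hy')).1] at h
    exact h.hasDerivAt
  have hu_deriv {x : ℝ} (hx : x ∈ Set.Ioo a b) : HasDerivAt u (G (linv x)) x := by
    have hy := hlinv_Ioo hx
    have hw0 : (w (linv x) : ℂ) ≠ 0 :=
      Complex.ofReal_ne_zero.2 (hwpos (Set.Ioo_subset_Icc_self hy)).ne'
    have hwd := ((hwC hy).differentiableAt two_ne_zero).hasDerivAt.ofReal_comp
    have hvd := ((hv.contDiffAt (hnhds hy)).differentiableAt two_ne_zero).hasDerivAt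
    have h := (hvd.div hwd hw0).scomp x (hlinv_deriv hx)
    refine (h.congr_of_eventuallyEq ?_).congr_deriv ?_
    · filter_upwards [Ioo_mem_nhds hx.1 hx.2] with z hz
      rw [hu, hρw (hlinv_maps (Set.Ioo_subset_Icc_self hz))]
      simp [div_eq_inv_mul]
    · simp only [hG, Complex.real_smul]
      push_cast
      field_simp
  have hu_deriv2 {x : ℝ} (hx : x ∈ Set.Ioo a b) :
      deriv (deriv u) x = ((p (linv x) * w (linv x) ^ 2 : ℝ) : ℂ) *
        ((w (linv x) : ℂ) * deriv (fun t => (p t : ℂ) * deriv v t) (linv x) -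
          v (linv x) * ((deriv (fun t => p t * deriv w t) (linv x) : ℝ) : ℂ)) := by
    have hy := hlinv_Ioo hx
    have h := (hasDerivAt_liouville_quasiDerivative (hp.contDiffAt (hnhds hy)) (hwC hy)
      (hv.contDiffAt (hnhds hy))).scomp x (hlinv_deriv hx)
    rw [← Complex.real_smul, ← h.deriv]
    refine Filter.EventuallyEq.deriv_eq ?_
    filter_upwards [Ioo_mem_nhds hx.1 hx.2] with z hz
    exact (hu_deriv hz).deriv
  have hpointwise {x : ℝ} (hx : x ∈ Set.Ioo a b) :
      deriv (deriv u) x - Q x * u x - -lam * u x =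
        ((p (linv x) * w (linv x) ^ 3 : ℝ) : ℂ) *
          (deriv (fun t => (p t : ℂ) * deriv v t) (linv x) - q (linv x) * v (linv x) -
            -lam * (r (linv x) : ℂ) * v (linv x)) := by
    have hy := Set.Ioo_subset_Icc_self (hlinv_Ioo hx)
    obtain ⟨-, h4, hcoef⟩ := liouville_weight_identities (hppos _ hy) (hrpos _ hy)
    have h4' : (p (linv x) : ℂ) * r (linv x) * (w (linv x) : ℂ) ^ 4 = 1 := by
      exact_mod_cast h4
    have hw0 : (w (linv x) : ℂ) ≠ 0 := Complex.ofReal_ne_zero.2 (hwpos hy).ne'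
    have hr0 : (r (linv x) : ℂ) ≠ 0 := Complex.ofReal_ne_zero.2 (hrpos _ hy).ne'
    rw [hu_deriv2 hx, hQ, hu, hρw hy, hcoef]
    change _ - (_ - ((p (linv x) * w (linv x) ^ 3 *
      deriv (fun t => p t * deriv w t) (linv x) : ℝ) : ℂ)) * _ - _ = _
    push_cast
    field_simp
    linear_combination (q (linv x) * v (linv x) - lam * r (linv x) * v (linv x)) * h4'
  have hfactor {x : ℝ} (hx : x ∈ Set.Ioo a b) :
      ((p (linv x) * w (linv x) ^ 3 : ℝ) : ℂ) ≠ 0 := by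
    have hy := Set.Ioo_subset_Icc_self (hlinv_Ioo hx)
    exact Complex.ofReal_ne_zero.2 (mul_pos (hppos _ hy) (pow_pos (hwpos hy) 3)).ne'
  constructor
  · intro h x hx
    rw [← sub_eq_zero, hpointwise hx, sub_eq_zero.2 (h _ (hlinv_Ioo hx)), mul_zero]
  · intro h y hy
    have hy' := Set.Ioo_subset_Icc_self hy
    have hx : l y ∈ Set.Ioo a b := by
      rw [ha, hb]
      exact ⟨hmono (Set.left_mem_Icc.2 hAB.le) hy' hy.1,
        hmono hy' (Set.right_mem_Icc.2 hAB.le) hy.2⟩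
    have hzero := hpointwise hx
    rw [sub_eq_zero.2 (h _ hx), hlinv_left y hy'] at hzero
    have hne := hfactor hx
    rw [hlinv_left y hy'] at hne
    exact sub_eq_zero.1 ((mul_eq_zero.1 hzero.symm).resolve_left hne)
end

section
/- Let g : [A,B] → ℂ be twice continuously differentiable, satisfy (p(y) g′(y))′ − q(y) g(y) = 0 for all y ∈ (A,B), and have g(y) ≠ 0 for all y ∈ [A,B]. Then the function f(x) = ρ(l⁻¹(x)) g(l⁻¹(x)) satisfies f″(x) − Q(x) f(x) = 0 for all x ∈ (a,b) and f(x) ≠ 0 for all x ∈ [a,b]. -/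
open MeasureTheory

theorem exists_fourth_root {x : ℝ} (hx : 0 < x) : ∃ s : ℝ, 0 < s ∧ x = s ^ 4 :=
  ⟨x ^ (1 / 4 : ℝ), Real.rpow_pos_of_pos hx _, by
    rw [← Real.rpow_natCast, ← Real.rpow_mul hx.le]; norm_num⟩

theorem rpow_one_fourth_pow_four {s : ℝ} (hs : 0 ≤ s) : (s ^ 4) ^ (1 / 4 : ℝ) = s := by
  rw [← Real.rpow_natCast, ← Real.rpow_mul hs]; norm_num

theorem sqrt_pow_four_div {s t : ℝ} (hs : 0 < s) (ht : 0 < t) :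
    √(t ^ 4 / s ^ 4) = t ^ 2 / s ^ 2 := by
  rw [show t ^ 4 / s ^ 4 = (t ^ 2 / s ^ 2) ^ 2 by field_simp]
  exact Real.sqrt_sq (by positivity)

theorem liouville_coeff_first {P R : ℝ} (hP : 0 < P) (hR : 0 < R) :
    ((P * R) ^ (-(1 / 4) : ℝ)) ^ 2 * √(R / P) * P = 1 := by
  obtain ⟨s, hs, rfl⟩ := exists_fourth_root hP
  obtain ⟨t, ht, rfl⟩ := exists_fourth_root hR
  rw [sqrt_pow_four_div hs ht, ← mul_pow, Real.rpow_neg (by positivity),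
    rpow_one_fourth_pow_four (by positivity)]
  field_simp

theorem liouville_coeff_potential {P R : ℝ} (hP : 0 < P) (hR : 0 < R) :
    (P * R) ^ (-(1 / 4) : ℝ) * R = (P * R) ^ (1 / 4 : ℝ) * √(R / P) := by
  obtain ⟨s, hs, rfl⟩ := exists_fourth_root hP
  obtain ⟨t, ht, rfl⟩ := exists_fourth_root hR
  rw [sqrt_pow_four_div hs ht, ← mul_pow, Real.rpow_neg (by positivity),
    rpow_one_fourth_pow_four (by positivity)]
  field_simp

theorem liouville_coeff_correction {P R : ℝ} (hP : 0 < P) (hR : 0 < R) :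
    (P / R ^ 3) ^ (1 / 4 : ℝ) * (P * R) ^ (1 / 4 : ℝ) * √(R / P) = 1 := by
  obtain ⟨s, hs, rfl⟩ := exists_fourth_root hP
  obtain ⟨t, ht, rfl⟩ := exists_fourth_root hR
  rw [sqrt_pow_four_div hs ht, ← mul_pow,
    show s ^ 4 / (t ^ 4) ^ 3 = (s / t ^ 3) ^ 4 by field_simp,
    rpow_one_fourth_pow_four (by positivity), rpow_one_fourth_pow_four (by positivity)]
  field_simp

theorem ContDiffOn.differentiableAt_deriv_of_isOpen {E : Type*} [NormedAddCommGroup E]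
    [NormedSpace ℝ E] {h : ℝ → E} {s : Set ℝ} (hh : ContDiffOn ℝ 2 h s) (hs : IsOpen s)
    {y : ℝ} (hy : y ∈ s) : DifferentiableAt ℝ (deriv h) y :=
  ((hh.deriv_of_isOpen (m := 1) hs (by norm_num)).differentiableOn one_ne_zero).differentiableAt
    (hs.mem_nhds hy)

theorem ContinuousOn.hasDerivAt_integral {h : ℝ → ℝ} {A B y₀ y : ℝ}
    (hh : ContinuousOn h (Set.Icc A B)) (hy₀ : y₀ ∈ Set.Icc A B) (hy : y ∈ Set.Ioo A B) :
    HasDerivAt (fun u => ∫ s in y₀..u, h s) (h y) y := by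
  refine intervalIntegral.integral_hasDerivAt_right
    (hh.mono (Set.uIcc_subset_Icc hy₀ (Set.Ioo_subset_Icc_self hy))).intervalIntegrable ?_
    (hh.continuousAt (Icc_mem_nhds hy.1 hy.2))
  exact (hh.mono Set.Ioo_subset_Icc_self).stronglyMeasurableAtFilter isOpen_Ioo y hy

theorem mem_Ioo_of_rightInverse {l k : ℝ → ℝ} {A B x : ℝ}
    (hk : Set.MapsTo k (Set.Icc (l A) (l B)) (Set.Icc A B))
    (hlk : ∀ z ∈ Set.Icc (l A) (l B), l (k z) = z) (hx : x ∈ Set.Ioo (l A) (l B)) :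
    k x ∈ Set.Ioo A B := by
  have hx' := Set.Ioo_subset_Icc_self hx
  have h := hk hx'
  refine ⟨lt_of_le_of_ne h.1 ?_, lt_of_le_of_ne h.2 ?_⟩
  · intro e; have := hlk x hx'; rw [← e] at this; exact hx.1.ne this
  · intro e; have := hlk x hx'; rw [e] at this; exact hx.2.ne' this

theorem StrictMonoOn.continuousAt_rightInverse {l k : ℝ → ℝ} {A B x : ℝ}
    (hl : StrictMonoOn l (Set.Icc A B))
    (hk : Set.MapsTo k (Set.Icc (l A) (l B)) (Set.Icc A B))
    (hlk : ∀ z ∈ Set.Icc (l A) (l B), l (k z) = z)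
    (hkl : ∀ y ∈ Set.Icc A B, k (l y) = y) (hx : x ∈ Set.Ioo (l A) (l B)) :
    ContinuousAt k x := by
  have hkx := mem_Ioo_of_rightInverse hk hlk hx
  have hAB : A ≤ B := (hkx.1.trans hkx.2).le
  have hmono : StrictMonoOn k (Set.Icc (l A) (l B)) := fun u hu v hv huv => by
    rwa [← hl.lt_iff_lt (hk hu) (hk hv), hlk u hu, hlk v hv]
  refine hmono.continuousAt_of_image_mem_nhds (Icc_mem_nhds hx.1 hx.2)
    (Filter.mem_of_superset (Icc_mem_nhds hkx.1 hkx.2) fun y hy => ⟨l y, ?_, hkl y hy⟩)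
  exact ⟨hl.monotoneOn (Set.left_mem_Icc.2 hAB) hy hy.1,
    hl.monotoneOn hy (Set.right_mem_Icc.2 hAB) hy.2⟩

theorem liouville_transform_of_homogeneous_solution
    (A B : ℝ) (hAB : A < B)
    (p r : ℝ → ℝ) (q : ℝ → ℂ)
    (hp : ContDiffOn ℝ 2 p (Set.Icc A B))
    (hr : ContDiffOn ℝ 2 r (Set.Icc A B))
    (hq : ContinuousOn q (Set.Icc A B))
    (hppos : ∀ y ∈ Set.Icc A B, 0 < p y)
    (hrpos : ∀ y ∈ Set.Icc A B, 0 < r y)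
    (y₀ : ℝ) (hy₀ : y₀ ∈ Set.Icc A B)
    (l : ℝ → ℝ) (hl : ∀ y, l y = ∫ s in y₀..y, Real.sqrt (r s / p s))
    (ρ : ℝ → ℝ) (hρ : ∀ y, ρ y = (p y * r y) ^ (1 / 4 : ℝ))
    (a b : ℝ) (ha : a = l A) (hb : b = l B)
    (hmono : StrictMonoOn l (Set.Icc A B))
    (linv : ℝ → ℝ)
    (hlinv_maps : Set.MapsTo linv (Set.Icc a b) (Set.Icc A B))
    (hlinv_left : ∀ y ∈ Set.Icc A B, linv (l y) = y)
    (hlinv_right : ∀ x ∈ Set.Icc a b, l (linv x) = x)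
    (Q : ℝ → ℂ)
    (hQ : ∀ x, Q x = q (linv x) / (r (linv x) : ℂ) -
      (((p (linv x) / (r (linv x)) ^ 3) ^ (1 / 4 : ℝ) *
        deriv (fun t => p t * deriv (fun s => (p s * r s) ^ (-(1 / 4) : ℝ)) t) (linv x) : ℝ) : ℂ))
    (g : ℝ → ℂ) (hg : ContDiffOn ℝ 2 g (Set.Icc A B))
    (hgeq : ∀ y ∈ Set.Ioo A B,
      deriv (fun t => (p t : ℂ) * deriv g t) y - q y * g y = 0)
    (hgne : ∀ y ∈ Set.Icc A B, g y ≠ 0)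
    (f : ℝ → ℂ) (hf : ∀ x, f x = (ρ (linv x) : ℂ) * g (linv x)) :
    (∀ x ∈ Set.Ioo a b, deriv (deriv f) x - Q x * f x = 0) ∧
    (∀ x ∈ Set.Icc a b, f x ≠ 0) := by
  have hsub := Set.Ioo_subset_Icc_self (a := A) (b := B)
  have hρpos : ∀ y ∈ Set.Icc A B, 0 < ρ y := fun y hy => by
    rw [hρ]; exact Real.rpow_pos_of_pos (mul_pos (hppos y hy) (hrpos y hy)) _
  refine ⟨?_, fun x hx => ?_⟩
  swap
  · rw [hf]
    have hy := hlinv_maps hx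
    exact mul_ne_zero (Complex.ofReal_ne_zero.2 (hρpos _ hy).ne') (hgne _ hy)
  subst ha hb
  set w : ℝ → ℝ := fun s => √(r s / p s)
  set u : ℝ → ℝ := fun s => (p s * r s) ^ (-(1 / 4) : ℝ)
  have hwpos : ∀ y ∈ Set.Icc A B, 0 < w y := fun y hy =>
    Real.sqrt_pos.2 (div_pos (hrpos y hy) (hppos y hy))
  have hupos : ∀ y ∈ Set.Icc A B, 0 < u y := fun y hy =>
    Real.rpow_pos_of_pos (mul_pos (hppos y hy) (hrpos y hy)) _
  have hwcont : ContinuousOn w (Set.Icc A B) :=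
    (hr.continuousOn.div hp.continuousOn fun y hy => (hppos y hy).ne').sqrt
  have hu2 : ContDiffOn ℝ 2 u (Set.Icc A B) :=
    (hp.mul hr).rpow_const_of_ne fun y hy => (mul_pos (hppos y hy) (hrpos y hy)).ne'
  have hdiff : ∀ {E : Type} [NormedAddCommGroup E] [NormedSpace ℝ E] {h : ℝ → E},
      ContDiffOn ℝ 2 h (Set.Icc A B) → ∀ y ∈ Set.Ioo A B,
        DifferentiableAt ℝ h y ∧ DifferentiableAt ℝ (deriv h) y := fun hh y hy =>
    ⟨(hh.contDiffAt (Icc_mem_nhds hy.1 hy.2)).differentiableAt two_ne_zero,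
      (hh.mono hsub).differentiableAt_deriv_of_isOpen isOpen_Ioo hy⟩
  have hmem : ∀ x ∈ Set.Ioo (l A) (l B), linv x ∈ Set.Ioo A B := fun x hx =>
    mem_Ioo_of_rightInverse hlinv_maps hlinv_right hx
  have hlinv_deriv : ∀ x ∈ Set.Ioo (l A) (l B),
      HasDerivAt linv (w (linv x))⁻¹ x := fun x hx => by
    have hldiff : HasDerivAt l (w (linv x)) (linv x) := by
      rw [show l = fun y => ∫ s in y₀..y, w s from funext hl]
      exact hwcont.hasDerivAt_integral hy₀ (hmem x hx)
    refine hldiff.of_local_left_inverse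
      (hmono.continuousAt_rightInverse hlinv_maps hlinv_right hlinv_left hx)
      (hwpos _ (hsub (hmem x hx))).ne' ?_
    filter_upwards [Icc_mem_nhds hx.1 hx.2] with z hz using hlinv_right z hz
  -- The derivative of `f`, expressed in the variable `y = linv x`.
  set m : ℝ → ℂ := fun y => (u y : ℂ) * ((p y : ℂ) * deriv g y) -
    ((p y * deriv u y : ℝ) : ℂ) * g y with hm
  have hf_deriv : ∀ x ∈ Set.Ioo (l A) (l B), HasDerivAt f (m (linv x)) x := fun x hx => by
    have hy := hmem x hx
    have hyI := hsub hy
    have hune : (u (linv x) : ℂ) ≠ 0 := Complex.ofReal_ne_zero.2 (hupos _ hyI).ne'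
    have hquot : HasDerivAt (fun y => g y / (u y : ℂ)) _ (linv x) :=
      (hdiff hg _ hy).1.hasDerivAt.div (hdiff hu2 _ hy).1.hasDerivAt.ofReal_comp hune
    have hcomp := hquot.scomp x (hlinv_deriv x hx)
    have hEq : f =ᶠ[nhds x] (fun y => g y / (u y : ℂ)) ∘ linv := by
      filter_upwards [Ioo_mem_nhds hx.1 hx.2] with z hz
      have hz' := hsub (hmem z hz)
      have : u (linv z) = (ρ (linv z))⁻¹ := by
        rw [hρ]; exact Real.rpow_neg (mul_pos (hppos _ hz') (hrpos _ hz')).le _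
      rw [hf, Function.comp_apply, this, Complex.ofReal_inv, div_inv_eq_mul, mul_comm]
    refine (hcomp.congr_of_eventuallyEq hEq).congr_deriv ?_
    have hwne : (w (linv x) : ℂ) ≠ 0 := Complex.ofReal_ne_zero.2 (hwpos _ hyI).ne'
    have key : (u (linv x) : ℂ) ^ 2 * w (linv x) * p (linv x) = 1 := by
      exact_mod_cast liouville_coeff_first (hppos _ hyI) (hrpos _ hyI)
    simp only [hm, Complex.real_smul, Complex.ofReal_inv, Complex.ofReal_mul]
    field_simp
    linear_combination (g (linv x) * ((deriv u (linv x) : ℝ) : ℂ) -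
      (u (linv x) : ℂ) * deriv g (linv x)) * key
  intro x hx
  have hy := hmem x hx
  have hyI := hsub hy
  have hm_deriv : HasDerivAt m ((u (linv x) : ℂ) * (q (linv x) * g (linv x)) -
      ((deriv (fun t => p t * deriv u t) (linv x) : ℝ) : ℂ) * g (linv x)) (linv x) := by
    have hpd := (hdiff hp _ hy).1
    have hpg : HasDerivAt (fun t => (p t : ℂ) * deriv g t) (q (linv x) * g (linv x)) (linv x) := by
      rw [← sub_eq_zero.1 (hgeq _ hy)]
      exact (hpd.hasDerivAt.ofReal_comp.differentiableAt.mul (hdiff hg _ hy).2).hasDerivAt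
    have hpu := (hpd.mul (hdiff hu2 _ hy).2).hasDerivAt
    refine (((hdiff hu2 _ hy).1.hasDerivAt.ofReal_comp.mul hpg).sub
      (hpu.ofReal_comp.mul (hdiff hg _ hy).1.hasDerivAt)).congr_deriv ?_
    simp only [Complex.ofReal_mul, Pi.mul_def]
    ring
  have hEq : deriv f =ᶠ[nhds x] m ∘ linv := by
    filter_upwards [Ioo_mem_nhds hx.1 hx.2] with z hz using (hf_deriv z hz).deriv
  have hf2 := ((hm_deriv.scomp x (hlinv_deriv x hx)).congr_of_eventuallyEq hEq).deriv
  have hwne : (w (linv x) : ℂ) ≠ 0 := Complex.ofReal_ne_zero.2 (hwpos _ hyI).ne'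
  have hrne : (r (linv x) : ℂ) ≠ 0 := Complex.ofReal_ne_zero.2 (hrpos _ hyI).ne'
  have hpot : (u (linv x) : ℂ) * r (linv x) = ρ (linv x) * w (linv x) := by
    rw [hρ]; exact_mod_cast liouville_coeff_potential (hppos _ hyI) (hrpos _ hyI)
  have hcorr : (((p (linv x) / r (linv x) ^ 3) ^ (1 / 4 : ℝ) : ℝ) : ℂ) * ρ (linv x) *
      w (linv x) = 1 := by
    rw [hρ]; exact_mod_cast liouville_coeff_correction (hppos _ hyI) (hrpos _ hyI)
  rw [hf2, hQ, hf, Complex.real_smul, Complex.ofReal_inv, Complex.ofReal_mul]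
  generalize ((p (linv x) / r (linv x) ^ 3) ^ (1 / 4 : ℝ) : ℝ) = c at hcorr ⊢
  field_simp
  linear_combination q (linv x) * g (linv x) * hpot +
    (r (linv x) : ℂ) * g (linv x) * ((deriv (fun t => p t * deriv u t) (linv x) : ℝ) : ℂ) * hcorr
end
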